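/- Let 0 < α < 1, r > 0, T > 0, let f : [0,T] × ℝ × ℝ → ℝ be continuous with |f(t,υ₁,ϑ) − f(t,υ₂,ϑ)| ≤ L|υ₁ − υ₂| for all υ₁,υ₂,ϑ ∈ ℝ, t ∈ [0,T], where L > 0, and let φ : [−r,0] → ℝ be continuous. Let 0 ≤ a and 0 < S ≤ r with a + S ≤ T, and suppose φ₁ : [−r,a] → ℝ is continuous, φ₁ = φ on [−r,0], and φ₁(t) = φ(0) + (1/Γ(α)) ∫₀ᵗ (t−s)^{α−1} f(s, φ₁(s), φ₁(s−r)) ds for t ∈ [0,a]. Then there exists a unique continuous function υ : [−r, a+S] → ℝ such that υ = φ₁ on [−r,a] and υ(t) = φ(0) + (1/Γ(α)) ∫₀ᵗ (t−s)^{α−1} f(s, υ(s), υ(s−r)) ds for t ∈ [a, a+S]. -/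

import Mathlib

open Real Set

theorem intervalIntegrable_sub_rpow_mul {α t : ℝ} (hα : 0 < α) (ht : 0 ≤ t) {h : ℝ → ℝ}
    (hh : ContinuousOn h (Icc 0 t)) :
    IntervalIntegrable (fun s => (t - s) ^ (α - 1) * h s) MeasureTheory.volume 0 t := by
  have h1 : IntervalIntegrable (fun x : ℝ => x ^ (α - 1)) MeasureTheory.volume 0 t :=
    intervalIntegral.intervalIntegrable_rpow' (by linarith)
  have h2 := (h1.comp_sub_left t).symm
  simp only [sub_zero, sub_self] at h2
  exact h2.mul_continuousOn (by rwa [uIcc_of_le ht])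

theorem integral_sub_rpow_mul_exp_le {α t l : ℝ} (hα : 0 < α) (ht : 0 ≤ t) (hl : 0 < l) :
    ∫ s in (0:ℝ)..t, (t - s) ^ (α - 1) * exp (l * s) ≤ exp (l * t) * (Real.Gamma α / l ^ α) := by
  have h1 : ∫ s in (0:ℝ)..t, (t - s) ^ (α - 1) * exp (l * s)
      = ∫ x in (0:ℝ)..t, exp (l * t) * (x ^ (α - 1) * exp (-(l * x))) := by
    have := intervalIntegral.integral_comp_sub_left
      (a := 0) (b := t) (fun x : ℝ => exp (l * t) * (x ^ (α - 1) * exp (-(l * x)))) t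
    simp only [sub_zero, sub_self] at this
    rw [← this]
    congr 1
    ext s
    rw [mul_left_comm, ← Real.exp_add]
    ring_nf
  rw [h1, intervalIntegral.integral_const_mul]
  gcongr
  have hint := Real.integral_rpow_mul_exp_neg_mul_Ioi hα hl
  have hG : (1 / l) ^ α * Real.Gamma α = Real.Gamma α / l ^ α := by
    rw [Real.div_rpow zero_le_one hl.le, Real.one_rpow]; ring
  rw [hG] at hint
  rw [← hint, intervalIntegral.integral_of_le ht]
  apply MeasureTheory.setIntegral_mono_set
  · by_contra hni
    rw [MeasureTheory.integral_undef hni] at hint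
    have := Real.Gamma_pos_of_pos hα
    have : 0 < Real.Gamma α / l ^ α := by positivity
    linarith
  · filter_upwards [MeasureTheory.ae_restrict_mem measurableSet_Ioi] with x hx
    have : (0:ℝ) < x := hx
    simp only [Pi.zero_apply]
    positivity
  · exact Filter.Eventually.of_forall fun x hx => hx.1

theorem abs_integral_sub_rpow_mul_sub_le {α t l C : ℝ} (hα : 0 < α) (ht : 0 ≤ t) (hl : 0 < l)
    (hC : 0 ≤ C) {p q : ℝ → ℝ} (hp : ContinuousOn p (Icc 0 t)) (hq : ContinuousOn q (Icc 0 t))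
    (hpq : ∀ s ∈ Icc 0 t, |p s - q s| ≤ C * exp (l * s)) :
    |(∫ s in (0:ℝ)..t, (t - s) ^ (α - 1) * p s) - ∫ s in (0:ℝ)..t, (t - s) ^ (α - 1) * q s|
      ≤ C * (exp (l * t) * (Real.Gamma α / l ^ α)) := by
  rw [← intervalIntegral.integral_sub (intervalIntegrable_sub_rpow_mul hα ht hp)
    (intervalIntegrable_sub_rpow_mul hα ht hq)]
  have hE : ContinuousOn (fun s => C * exp (l * s)) (Icc 0 t) := by fun_prop
  calc _ ≤ ∫ s in (0:ℝ)..t, (t - s) ^ (α - 1) * (C * exp (l * s)) := by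
        rw [← Real.norm_eq_abs]
        refine intervalIntegral.norm_integral_le_of_norm_le ht ?_
          (intervalIntegrable_sub_rpow_mul hα ht hE)
        refine Filter.Eventually.of_forall fun s hs => ?_
        have h0 : 0 ≤ (t - s) ^ (α - 1) := Real.rpow_nonneg (by linarith [hs.2]) _
        rw [← mul_sub, norm_mul, Real.norm_of_nonneg h0, Real.norm_eq_abs]
        exact mul_le_mul_of_nonneg_left (hpq s ⟨hs.1.le, hs.2⟩) h0
    _ = C * ∫ s in (0:ℝ)..t, (t - s) ^ (α - 1) * exp (l * s) := by
        rw [← intervalIntegral.integral_const_mul]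
        congr 1; ext s; ring
    _ ≤ _ := mul_le_mul_of_nonneg_left (integral_sub_rpow_mul_exp_le hα ht hl) hC

theorem integral_sub_rpow_mul_eq {α t : ℝ} (hα : 0 < α) (ht : 0 ≤ t) (h : ℝ → ℝ) :
    ∫ s in (0:ℝ)..t, (t - s) ^ (α - 1) * h s
      = t ^ α * ∫ y in (0:ℝ)..1, (1 - y) ^ (α - 1) * h (t * y) := by
  rcases ht.eq_or_lt with rfl | ht
  · simp [Real.zero_rpow hα.ne']
  have h1 := intervalIntegral.mul_integral_comp_mul_left (a := 0) (b := 1)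
    (f := fun s => (t - s) ^ (α - 1) * h s) t
  simp only [mul_zero, mul_one] at h1
  rw [← h1, ← intervalIntegral.integral_const_mul, ← intervalIntegral.integral_const_mul]
  refine intervalIntegral.integral_congr fun y hy => ?_
  rw [uIcc_of_le zero_le_one] at hy
  have h2 : t ^ α = t * t ^ (α - 1) := by
    rw [Real.rpow_sub_one ht.ne']; field_simp
  have h3 : t - t * y = t * (1 - y) := by ring
  rw [h3, Real.mul_rpow ht.le (by linarith [hy.2]), h2]
  ring

theorem continuousOn_integral_sub_rpow_mul {α : ℝ} (hα : 0 < α) {h : ℝ → ℝ} (hh : Continuous h) :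
    ContinuousOn (fun t => ∫ s in (0:ℝ)..t, (t - s) ^ (α - 1) * h s) (Ici 0) := by
  have hk : IntervalIntegrable (fun y : ℝ => (1 - y) ^ (α - 1)) MeasureTheory.volume 0 1 := by
    simpa using intervalIntegrable_sub_rpow_mul (t := 1) hα zero_le_one
      (h := fun _ => 1) continuousOn_const
  have hc : Continuous fun t => ∫ y in (0:ℝ)..1, (1 - y) ^ (α - 1) * h (t * y) := by
    rw [continuous_iff_continuousAt]
    intro t₀
    obtain ⟨M, hM⟩ := (isCompact_Icc (a := -(|t₀| + 1)) (b := |t₀| + 1)).exists_bound_of_continuousOn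
      hh.continuousOn
    refine intervalIntegral.continuousAt_of_dominated_interval
      (bound := fun y => (1 - y) ^ (α - 1) * M) ?_ ?_ (hk.mul_const M) ?_
    · refine Filter.Eventually.of_forall fun t => ?_
      have hc : Continuous fun y => h (t * y) := by fun_prop
      exact (hk.def'.aestronglyMeasurable).mul hc.aestronglyMeasurable
    · filter_upwards [Metric.ball_mem_nhds t₀ one_pos] with t ht
      refine Filter.Eventually.of_forall fun y hy => ?_
      rw [uIoc_of_le zero_le_one] at hy
      have h0 : 0 ≤ (1 - y) ^ (α - 1) := Real.rpow_nonneg (by linarith [hy.2]) _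
      rw [norm_mul, Real.norm_of_nonneg h0]
      refine mul_le_mul_of_nonneg_left (hM _ (abs_le.mp ?_)) h0
      rw [Metric.mem_ball, Real.dist_eq] at ht
      have h1 : |t| ≤ |t₀| + 1 := by
        have := abs_sub_abs_le_abs_sub t t₀
        linarith
      rw [abs_mul, abs_of_pos hy.1]
      exact (mul_le_of_le_one_right (abs_nonneg t) hy.2).trans h1
    · refine Filter.Eventually.of_forall fun y _ => ?_
      fun_prop
  refine ((Real.continuous_rpow_const hα.le).mul hc).continuousOn.congr fun t ht => ?_
  exact integral_sub_rpow_mul_eq hα ht h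

theorem exists_rate_div_rpow_eq_half {α L : ℝ} (hα : 0 < α) (hL : 0 < L) :
    ∃ l : ℝ, 0 < l ∧ L / l ^ α = 1 / 2 := by
  refine ⟨(2 * L) ^ α⁻¹, by positivity, ?_⟩
  rw [Real.rpow_inv_rpow (by positivity) hα.ne']
  field_simp

theorem volterra_unique {α b L c : ℝ} (hα : 0 < α) (hL : 0 < L) (hb : 0 ≤ b) {g : ℝ → ℝ → ℝ}
    (hg : ContinuousOn (fun p : ℝ × ℝ => g p.1 p.2) (Icc 0 b ×ˢ univ))
    (hLip : ∀ t ∈ Icc 0 b, ∀ x y, |g t x - g t y| ≤ L * |x - y|)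
    {u v : ℝ → ℝ} (hu : ContinuousOn u (Icc 0 b)) (hv : ContinuousOn v (Icc 0 b))
    (hue : ∀ t ∈ Icc 0 b, u t = c +
      (1 / Real.Gamma α) * ∫ s in (0:ℝ)..t, (t - s) ^ (α - 1) * g s (u s))
    (hve : ∀ t ∈ Icc 0 b, v t = c +
      (1 / Real.Gamma α) * ∫ s in (0:ℝ)..t, (t - s) ^ (α - 1) * g s (v s)) :
    EqOn u v (Icc 0 b) := by
  obtain ⟨l, hl, hlL⟩ := exists_rate_div_rpow_eq_half hα hL
  have hΓ := Real.Gamma_pos_of_pos hα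
  have hgw : ∀ w : ℝ → ℝ, ContinuousOn w (Icc 0 b) →
      ContinuousOn (fun s => g s (w s)) (Icc 0 b) := fun w hw =>
    hg.comp (continuousOn_id.prodMk hw) fun s hs => ⟨hs, mem_univ _⟩
  have hD : ContinuousOn (fun t => |u t - v t| * exp (-(l * t))) (Icc 0 b) :=
    (hu.sub hv).abs.mul (by fun_prop)
  obtain ⟨t₀, ht₀, hmax⟩ := isCompact_Icc.exists_isMaxOn ⟨0, left_mem_Icc.mpr hb⟩ hD
  set K := |u t₀ - v t₀| * exp (-(l * t₀)) with hK
  have hK0 : 0 ≤ K := by positivity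
  have hle : ∀ t ∈ Icc 0 b, |u t - v t| ≤ K * exp (l * t) := fun t ht => by
    have : |u t - v t| * exp (-(l * t)) ≤ K := hmax ht
    rwa [Real.exp_neg, ← div_eq_mul_inv, div_le_iff₀ (exp_pos _)] at this
  have hsub : Icc 0 t₀ ⊆ Icc 0 b := Icc_subset_Icc_right ht₀.2
  have key := abs_integral_sub_rpow_mul_sub_le (C := L * K) hα ht₀.1 hl (by positivity)
    ((hgw u hu).mono hsub) ((hgw v hv).mono hsub) fun s hs =>
      (hLip s (hsub hs) _ _).trans (by
        rw [mul_assoc]; exact mul_le_mul_of_nonneg_left (hle s (hsub hs)) hL.le)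
  have h1 : |u t₀ - v t₀| ≤ K / 2 * exp (l * t₀) := by
    rw [hue t₀ ht₀, hve t₀ ht₀, add_sub_add_left_eq_sub, ← mul_sub, abs_mul,
      abs_of_pos (by positivity)]
    calc _ ≤ 1 / Real.Gamma α * (L * K * (exp (l * t₀) * (Real.Gamma α / l ^ α))) := by gcongr
      _ = (L / l ^ α) * K * exp (l * t₀) := by field_simp
      _ = _ := by rw [hlL]; ring
  have h2 : K ≤ K / 2 := by
    rw [← div_le_iff₀ (exp_pos _), div_eq_mul_inv, ← Real.exp_neg] at h1
    exact h1
  have hKz : K = 0 := by linarith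
  intro t ht
  have := hle t ht
  rw [hKz, zero_mul] at this
  exact sub_eq_zero.mp (abs_nonpos_iff.mp this)

theorem volterra_exists {α b L c : ℝ} (hα : 0 < α) (hL : 0 < L) (hb : 0 ≤ b) {g : ℝ → ℝ → ℝ}
    (hg : ContinuousOn (fun p : ℝ × ℝ => g p.1 p.2) (Icc 0 b ×ˢ univ))
    (hLip : ∀ t ∈ Icc 0 b, ∀ x y, |g t x - g t y| ≤ L * |x - y|) :
    ∃ u : ℝ → ℝ, Continuous u ∧ ∀ t ∈ Icc 0 b, u t = c +
      (1 / Real.Gamma α) * ∫ s in (0:ℝ)..t, (t - s) ^ (α - 1) * g s (u s) := by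
  obtain ⟨l, hl, hlL⟩ := exists_rate_div_rpow_eq_half hα hL
  have hΓ := Real.Gamma_pos_of_pos hα
  let G : ℝ → ℝ → ℝ := fun t x => g (projIcc 0 b hb t) x
  have hGg : ∀ t ∈ Icc 0 b, G t = g t := fun t ht => by
    simp only [G, projIcc_of_mem hb ht]
  have hG : Continuous fun p : ℝ × ℝ => G p.1 p.2 :=
    hg.comp_continuous (f := fun p : ℝ × ℝ => ((projIcc 0 b hb p.1 : ℝ), p.2)) (by fun_prop)
      fun p => ⟨(projIcc 0 b hb p.1).2, mem_univ _⟩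
  -- the solution is sought in the form `exp (l * t) * w t`
  let U : C(Icc 0 b, ℝ) → ℝ → ℝ := fun w t => exp (l * t) * IccExtend hb w t
  have hU : ∀ w, Continuous (U w) := fun w => by
    have : Continuous (IccExtend hb w) := w.continuous.Icc_extend'
    fun_prop
  have hGU : ∀ w, Continuous fun s => G s (U w s) := fun w =>
    hG.comp (continuous_id.prodMk (hU w))
  let I : C(Icc 0 b, ℝ) → ℝ → ℝ := fun w t => ∫ s in (0:ℝ)..t, (t - s) ^ (α - 1) * G s (U w s)
  let F : C(Icc 0 b, ℝ) → C(Icc 0 b, ℝ) := fun w =>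
    ⟨fun t => exp (-(l * t)) * (c + (1 / Real.Gamma α) * I w t), by
      have h1 : Continuous fun t : Icc 0 b => I w t :=
        (continuousOn_integral_sub_rpow_mul hα (hGU w)).comp_continuous continuous_subtype_val
          fun t => t.2.1
      have h2 : Continuous fun t : Icc 0 b => exp (-(l * (t : ℝ))) := by fun_prop
      exact h2.mul (continuous_const.add (continuous_const.mul h1))⟩
  have hF : ContractingWith (1 / 2) F := by
    refine ⟨by rw [← NNReal.coe_lt_coe]; norm_num, LipschitzWith.of_dist_le_mul fun w z => ?_⟩
    rw [ContinuousMap.dist_le (by positivity)]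
    intro t
    have hd : ∀ s ∈ Icc 0 (t:ℝ), |G s (U w s) - G s (U z s)| ≤ L * dist w z * exp (l * s) := by
      intro s hs
      refine (hLip _ (projIcc 0 b hb s).2 _ _).trans ?_
      rw [mul_assoc]
      refine mul_le_mul_of_nonneg_left ?_ hL.le
      simp only [U, IccExtend, Function.comp_apply]
      rw [← mul_sub, abs_mul, abs_of_pos (exp_pos _), mul_comm, ← Real.dist_eq]
      exact mul_le_mul_of_nonneg_right (ContinuousMap.dist_apply_le_dist _) (exp_pos _).le
    have key := abs_integral_sub_rpow_mul_sub_le hα t.2.1 hl (by positivity)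
      (hGU w).continuousOn (hGU z).continuousOn hd
    have he : exp (-(l * (t:ℝ))) * exp (l * t) = 1 := by rw [← Real.exp_add]; simp
    calc dist (F w t) (F z t) = exp (-(l * (t:ℝ))) * (1 / Real.Gamma α * |I w t - I z t|) := by
          simp only [F, ContinuousMap.coe_mk]
          rw [Real.dist_eq, ← mul_sub, add_sub_add_left_eq_sub, ← mul_sub, abs_mul, abs_mul,
            abs_of_pos (exp_pos _), abs_of_pos (show 0 < 1 / Real.Gamma α by positivity)]
      _ ≤ exp (-(l * (t:ℝ))) * (1 / Real.Gamma α *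
          (L * dist w z * (exp (l * t) * (Real.Gamma α / l ^ α)))) := by gcongr
      _ = (exp (-(l * (t:ℝ))) * exp (l * t)) * ((L / l ^ α) * dist w z) := by field_simp
      _ = _ := by rw [he, hlL]; norm_num
  have : Nonempty C(Icc 0 b, ℝ) := ⟨0⟩
  obtain ⟨w, hw⟩ : ∃ w, F w = w := ⟨_, hF.fixedPoint_isFixedPt⟩
  refine ⟨U w, hU w, fun t ht => ?_⟩
  have h1 : F w ⟨t, ht⟩ = w ⟨t, ht⟩ := by rw [hw]
  have h2 : U w t = exp (l * t) * F w ⟨t, ht⟩ := by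
    rw [h1]; simp only [U, IccExtend_of_mem hb w ht]
  have he : exp (l * t) * exp (-(l * t)) = 1 := by rw [← Real.exp_add]; simp
  have h3 : I w t = ∫ s in (0:ℝ)..t, (t - s) ^ (α - 1) * g s (U w s) := by
    refine intervalIntegral.integral_congr fun s hs => ?_
    rw [uIcc_of_le ht.1] at hs
    simp only [hGg s ⟨hs.1, hs.2.trans ht.2⟩]
  rw [h2, ← h3]
  simp only [F, ContinuousMap.coe_mk]
  rw [← mul_assoc, he, one_mul]

theorem progressive_contractions_extension_step
    (α r T L a S : ℝ) (hα0 : 0 < α) (hα1 : α < 1) (hr : 0 < r) (hT : 0 < T) (hL : 0 < L)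
    (ha : 0 ≤ a) (hS : 0 < S) (hSr : S ≤ r) (haS : a + S ≤ T)
    (f : ℝ → ℝ → ℝ → ℝ) (φ φ₁ : ℝ → ℝ)
    (hf : ContinuousOn (fun p : ℝ × ℝ × ℝ => f p.1 p.2.1 p.2.2)
      (Set.Icc 0 T ×ˢ (Set.univ : Set (ℝ × ℝ))))
    (hφ : ContinuousOn φ (Set.Icc (-r) 0))
    (hLip : ∀ t ∈ Set.Icc (0:ℝ) T, ∀ υ₁ υ₂ ϑ : ℝ,
      |f t υ₁ ϑ - f t υ₂ ϑ| ≤ L * |υ₁ - υ₂|)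
    (hφ₁cont : ContinuousOn φ₁ (Set.Icc (-r) a))
    (hφ₁init : Set.EqOn φ₁ φ (Set.Icc (-r) 0))
    (hφ₁eq : ∀ t ∈ Set.Icc (0:ℝ) a, φ₁ t = φ 0 +
      (1 / Real.Gamma α) * ∫ s in (0:ℝ)..t, (t - s) ^ (α - 1) * f s (φ₁ s) (φ₁ (s - r))) :
    ∃ υ : ℝ → ℝ,
      (ContinuousOn υ (Set.Icc (-r) (a + S)) ∧
        Set.EqOn υ φ₁ (Set.Icc (-r) a) ∧
        (∀ t ∈ Set.Icc a (a + S), υ t = φ 0 +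
          (1 / Real.Gamma α) * ∫ s in (0:ℝ)..t, (t - s) ^ (α - 1) * f s (υ s) (υ (s - r)))) ∧
      ∀ υ' : ℝ → ℝ,
        (ContinuousOn υ' (Set.Icc (-r) (a + S)) ∧
          Set.EqOn υ' φ₁ (Set.Icc (-r) a) ∧
          (∀ t ∈ Set.Icc a (a + S), υ' t = φ 0 +
            (1 / Real.Gamma α) * ∫ s in (0:ℝ)..t, (t - s) ^ (α - 1) * f s (υ' s) (υ' (s - r)))) →
        Set.EqOn υ υ' (Set.Icc (-r) (a + S)) := by
  have hb : 0 ≤ a + S := by linarith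
  let g : ℝ → ℝ → ℝ := fun s x => f s x (φ₁ (s - r))
  have hg : ContinuousOn (fun p : ℝ × ℝ => g p.1 p.2) (Icc 0 (a + S) ×ˢ univ) := by
    have hdelay : ContinuousOn (fun p : ℝ × ℝ => φ₁ (p.1 - r)) (Icc 0 (a + S) ×ˢ univ) :=
      hφ₁cont.comp (f := fun p : ℝ × ℝ => p.1 - r) (by fun_prop) fun p hp =>
        ⟨by linarith [hp.1.1], by linarith [hp.1.2]⟩
    exact hf.comp (continuousOn_fst.prodMk (continuousOn_snd.prodMk hdelay)) fun p hp =>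
      ⟨⟨hp.1.1, hp.1.2.trans haS⟩, mem_univ _⟩
  have hgLip : ∀ t ∈ Icc 0 (a + S), ∀ x y, |g t x - g t y| ≤ L * |x - y| := fun t ht x y =>
    hLip t ⟨ht.1, ht.2.trans haS⟩ x y _
  obtain ⟨u, huc, hue⟩ := volterra_exists (c := φ 0) hα0 hL hb hg hgLip
  have hsub : Icc 0 a ⊆ Icc 0 (a + S) := Icc_subset_Icc_right (by linarith)
  have huφ : EqOn u φ₁ (Icc 0 a) :=
    volterra_unique hα0 hL ha (hg.mono (prod_mono hsub subset_rfl))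
      (fun t ht => hgLip t (hsub ht)) huc.continuousOn
      (hφ₁cont.mono (Icc_subset_Icc_left (by linarith))) (fun t ht => hue t (hsub ht)) hφ₁eq
  let υ : ℝ → ℝ := fun t => if t ≤ a then φ₁ t else u t
  have hυφ : EqOn υ φ₁ (Iic a) := fun t ht => if_pos ht
  have hυu : EqOn υ u (Ici 0) := fun t ht => by
    by_cases h : t ≤ a
    · rw [hυφ h, huφ ⟨ht, h⟩]
    · exact if_neg h
  refine ⟨υ, ⟨?_, fun t ht => hυφ ht.2, fun t ht => ?_⟩, ?_⟩
  · rw [← Icc_union_Icc_eq_Icc (show -r ≤ a by linarith) (show a ≤ a + S by linarith)]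
    exact (hφ₁cont.congr fun t ht => hυφ ht.2).union_of_isClosed
      (huc.continuousOn.congr fun t ht => hυu (ha.trans ht.1)) isClosed_Icc isClosed_Icc
  · have ht0 : 0 ≤ t := ha.trans ht.1
    rw [hυu ht0, hue t ⟨ht0, ht.2⟩]
    congr 2
    refine intervalIntegral.integral_congr fun s hs => ?_
    rw [uIcc_of_le ht0] at hs
    simp only [g]
    rw [hυu hs.1, hυφ (show s - r ≤ a by linarith [hs.2, ht.2])]
  · rintro υ' ⟨hc', hφ', he'⟩
    have he : ∀ t ∈ Icc 0 (a + S), υ' t = φ 0 +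
        (1 / Real.Gamma α) * ∫ s in (0:ℝ)..t, (t - s) ^ (α - 1) * g s (υ' s) := by
      intro t ht
      rcases le_total t a with hta | hta
      · rw [hφ' ⟨by linarith [ht.1], hta⟩, hφ₁eq t ⟨ht.1, hta⟩]
        congr 2
        refine intervalIntegral.integral_congr fun s hs => ?_
        rw [uIcc_of_le ht.1] at hs
        simp only [g]
        rw [hφ' ⟨by linarith [hs.1], hs.2.trans hta⟩]
      · rw [he' t ⟨hta, ht.2⟩]
        congr 2
        refine intervalIntegral.integral_congr fun s hs => ?_
        rw [uIcc_of_le ht.1] at hs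
        simp only [g]
        rw [hφ' (⟨by linarith [hs.1], by linarith [hs.2, ht.2]⟩ : s - r ∈ Icc (-r) a)]
    have huυ' := volterra_unique hα0 hL hb hg hgLip huc.continuousOn
      (hc'.mono (Icc_subset_Icc_left (by linarith))) hue he
    intro t ht
    rcases le_total t a with hta | hta
    · rw [hυφ hta, hφ' ⟨ht.1, hta⟩]
    · rw [hυu (ha.trans hta), huυ' ⟨ha.trans hta, ht.2⟩]
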